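/- arXiv:dg-ga/9702016 — 2 statements merged into one kernel-verified Lean document; each statement's English description precedes it below -/
import Mathlib

section
/- (i) For all α, β ∈ {1,…,s}, the operators anticommute: B_α ∘ B_β + B_β ∘ B_α = 0 on ℋ_{k;r_1,…,r_s} (with the indices raised appropriately); in particular B_α ∘ B_α = 0. (ii) For every 0 ≤ k ≤ n, all r_1,…,r_s ≥ 0 and every X ∈ ℋ_{k; r_1,…,r_s}: k · r_α · B_α(T_α X) + (k+1) · (r_α+1) · T_α(B_α X) = (n + r_α − k) · X. (This is the anticommutation relation {B_α, B_α*} = N_α − N_f + n·1 between B_α and its adjoint, written via the trace maps.) -/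
open scoped BigOperators

namespace FockVar

/-- Multi-indices on `Fin n` of degree exactly `d` (encoding a symmetric slot of rank `d`). -/
abbrev MIe (n d : ℕ) : Type := {J : Fin n → ℕ // (∑ i, J i) = d}

/-- The space of tensors with `k` antisymmetric `Fin n` indices and `s` symmetric slots of
ranks `r 0, …, r (s-1)` (symmetric slots encoded by multi-indices, so that the symmetry
in each slot is automatic). -/
abbrev TT (n k s : ℕ) (r : Fin s → ℕ) : Type :=
  (Fin k → Fin n) → ((α : Fin s) → MIe n (r α)) → ℝ

/-- Antisymmetry in the `k` `Fin n`-indices: membership in `ℋ_{k;r_1,…,r_s}`. -/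
def IsAnti {n k s : ℕ} {r : Fin s → ℕ} (X : TT n k s r) : Prop :=
  ∀ (τ : Equiv.Perm (Fin k)) (i : Fin k → Fin n) (I : (α : Fin s) → MIe n (r α)),
    X (i ∘ τ) I = ((Equiv.Perm.sign τ : ℤ) : ℝ) * X i I

/-- Evaluation of a tensor on raw data, with built-in degree and arity checks
(returns `0` on mismatch). -/
def appT {n k s : ℕ} {r : Fin s → ℕ} (X : TT n k s r) {k' : ℕ}
    (i : Fin k' → Fin n) (K : Fin s → (Fin n → ℕ)) : ℝ :=
  if h : k' = k ∧ ∀ α, (∑ j, K α j) = r α then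
    X (fun a => i (Fin.cast h.1.symm a)) (fun α => ⟨K α, h.2 α⟩)
  else 0

/-- `J - e_{j₀}` (truncated subtraction). -/
def subF {n : ℕ} (J : Fin n → ℕ) (j0 : Fin n) : Fin n → ℕ :=
  fun j => J j - (if j = j0 then 1 else 0)

/-- `J + e_{j₀}`. -/
def addF {n : ℕ} (J : Fin n → ℕ) (j0 : Fin n) : Fin n → ℕ :=
  fun j => J j + (if j = j0 then 1 else 0)

/-- The raw value of `B_α X`:
`(B_α X) = Sym_{(j_0,…,j_{r_α})} Alt_{(i_0,…,i_k)} [ δ^{j_0}_{i_0} X^{(j_1,…,j_{r_α})}_{i_1,…,i_k} ]`,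
written in multi-index form. -/
noncomputable def Bval {n k s : ℕ} {r : Fin s → ℕ} (α : Fin s) (X : TT n k s r)
    {k' : ℕ} (i : Fin k' → Fin n) (K : Fin s → (Fin n → ℕ)) : ℝ :=
  if hk : k' = k + 1 then
    ((k'.factorial : ℕ) : ℝ)⁻¹ *
      ∑ τ : Equiv.Perm (Fin k'),
        ((Equiv.Perm.sign τ : ℤ) : ℝ) *
          ((K α (i (τ ⟨0, by omega⟩)) : ℝ) / ((r α : ℝ) + 1)) *
          appT X (fun l : Fin k => i (τ (Fin.cast hk.symm l.succ)))
            (Function.update K α (subF (K α) (i (τ ⟨0, by omega⟩))))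
  else 0

/-- The operator `B_α : ℋ_{k;r_1,…,r_α,…,r_s} → ℋ_{k+1;r_1,…,r_α+1,…,r_s}`. -/
noncomputable def Bop {n k s : ℕ} {r : Fin s → ℕ} (α : Fin s) (X : TT n k s r) :
    TT n (k+1) s (Function.update r α (r α + 1)) :=
  fun i I => Bval α X i (fun β => (I β).1)

/-- The raw value of the trace `T_α X`. -/
noncomputable def Tval {n k s : ℕ} {r : Fin s → ℕ} (α : Fin s) (X : TT n k s r)
    {k' : ℕ} (i : Fin k' → Fin n) (K : Fin s → (Fin n → ℕ)) : ℝ :=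
  ∑ j : Fin n, appT X (Fin.cons j i) (Function.update K α (addF (K α) j))

/-- The trace `T_α : ℋ_{k;r_1,…,r_α,…,r_s} → ℋ_{k−1;r_1,…,r_α−1,…,r_s}`. -/
noncomputable def Top {n k s : ℕ} {r : Fin s → ℕ} (α : Fin s) (X : TT n k s r) :
    TT n (k-1) s (Function.update r α (r α - 1)) :=
  fun i I => Tval α X i (fun β => (I β).1)

/-- The degree function produced by successive applications of the operators `B_α`,
`α` running through a list. -/
def chainDeg {s : ℕ} (r : Fin s → ℕ) : List (Fin s) → (Fin s → ℕ)
  | [] => r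
  | α :: l => Function.update (chainDeg r l) α (chainDeg r l α + 1)

/-- Iterated application `B_{α_1} ∘ ⋯ ∘ B_{α_t}` along a list `[α_1, …, α_t]`
(the head applied last), each `B` acting on the space produced by the previous ones. -/
noncomputable def chainB {n k s : ℕ} {r : Fin s → ℕ} :
    (l : List (Fin s)) → TT n k s r → TT n (k + l.length) s (chainDeg r l)
  | [], X => X
  | α :: l, X => Bop α (chainB l X)

theorem Bval_succ {n k s : ℕ} {r : Fin s → ℕ} (α : Fin s) (X : TT n k s r)
    (i : Fin (k+1) → Fin n) (K : Fin s → (Fin n → ℕ)) :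
    Bval α X i K = (((k+1).factorial : ℕ) : ℝ)⁻¹ *
      ∑ τ : Equiv.Perm (Fin (k+1)),
        ((Equiv.Perm.sign τ : ℤ) : ℝ) * ((K α (i (τ 0)) : ℝ) / ((r α : ℝ) + 1)) *
          appT X (fun l : Fin k => i (τ l.succ))
            (Function.update K α (subF (K α) (i (τ 0)))) := by
  unfold Bval
  rw [dif_pos rfl]
  rfl

theorem sum_subF {n : ℕ} (J : Fin n → ℕ) (a : Fin n) (h : J a ≠ 0) :
    (∑ j, subF J a j) + 1 = ∑ j, J j := by
  have : ∀ j, J j = subF J a j + (if j = a then 1 else 0) := by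
    intro j
    unfold subF
    split_ifs with hj
    · subst hj; omega
    · simp
  rw [Finset.sum_congr rfl (fun j _ => this j), Finset.sum_add_distrib]
  simp

theorem sum_addF {n : ℕ} (J : Fin n → ℕ) (a : Fin n) :
    (∑ j, addF J a j) = (∑ j, J j) + 1 := by
  unfold addF
  rw [Finset.sum_add_distrib]
  simp

theorem appT_Bop {n k s : ℕ} {r : Fin s → ℕ} (α : Fin s) (X : TT n k s r)
    (i : Fin (k+1) → Fin n) (K : Fin s → (Fin n → ℕ)) :
    appT (Bop α X) i K = Bval α X i K := by
  by_cases h : ∀ γ, (∑ j, K γ j) = Function.update r α (r α + 1) γ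
  · unfold appT
    rw [dif_pos ⟨rfl, h⟩]
    rfl
  · unfold appT
    rw [dif_neg (fun h' => h h'.2), Bval_succ]
    symm
    rw [Finset.sum_eq_zero, mul_zero]
    intro τ _
    by_cases h0 : K α (i (τ 0)) = 0
    · simp [h0]
    · unfold appT
      rw [dif_neg, mul_zero]
      rintro ⟨-, h2⟩
      apply h
      intro γ
      have h3 := h2 γ
      by_cases hγ : γ = α
      · subst hγ
        simp only [Function.update_self] at h3 ⊢
        rw [← sum_subF _ _ h0, h3]
      · simpa [Function.update_of_ne hγ] using h3

theorem appT_Top {n m s : ℕ} {r : Fin s → ℕ} (α : Fin s) (hr : r α ≠ 0) (X : TT n (m+1) s r)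
    (i : Fin m → Fin n) (K : Fin s → (Fin n → ℕ)) :
    appT (Top α X) i K = Tval α X i K := by
  by_cases h : ∀ γ, (∑ j, K γ j) = Function.update r α (r α - 1) γ
  · unfold appT
    rw [dif_pos ⟨rfl, h⟩]
    rfl
  · unfold appT
    rw [dif_neg (fun h' => h h'.2)]
    unfold Tval
    symm
    apply Finset.sum_eq_zero
    intro a _
    unfold appT
    rw [dif_neg]
    rintro ⟨-, h2⟩
    apply h
    intro γ
    have h3 := h2 γ
    by_cases hγ : γ = α
    · subst hγ
      simp only [Function.update_self, sum_addF] at h3 ⊢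
      omega
    · simpa [Function.update_of_ne hγ] using h3

theorem appT_anti {n k s : ℕ} {r : Fin s → ℕ} (X : TT n k s r) (hX : IsAnti X)
    (τ : Equiv.Perm (Fin k)) (i : Fin k → Fin n) (K : Fin s → (Fin n → ℕ)) :
    appT X (fun l => i (τ l)) K = ((Equiv.Perm.sign τ : ℤ) : ℝ) * appT X i K := by
  unfold appT
  split_ifs with h
  · exact hX τ i _
  · simp

/-- the summand of the double operator -/
noncomputable def FF {n k s : ℕ} {r : Fin s → ℕ} (β α : Fin s) (X : TT n k s r)
    (i : Fin (k+1+1) → Fin n) (K : Fin s → (Fin n → ℕ)) (τ : Equiv.Perm (Fin (k+1+1))) : ℝ :=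
  ((Equiv.Perm.sign τ : ℤ) : ℝ) *
    ((K β (i (τ 0)) : ℝ) / ((Function.update r α (r α + 1) β : ℕ) + 1 : ℝ)) *
    (((Function.update K β (subF (K β) (i (τ 0))) α (i (τ 1)) : ℕ) : ℝ) / ((r α : ℝ) + 1)) *
    appT X (fun l : Fin k => i (τ l.succ.succ))
      (Function.update (Function.update K β (subF (K β) (i (τ 0)))) α
        (subF (Function.update K β (subF (K β) (i (τ 0))) α) (i (τ 1))))

theorem Bval_Bop {n k s : ℕ} {r : Fin s → ℕ} (β α : Fin s) (X : TT n k s r)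
    (i : Fin (k+1+1) → Fin n) (K : Fin s → (Fin n → ℕ)) :
    Bval β (Bop α X) i K = (((k+1+1).factorial : ℕ) : ℝ)⁻¹ * ∑ τ, FF β α X i K τ := by
  rw [Bval_succ]
  congr 1
  have key : ∀ τ : Equiv.Perm (Fin (k+1+1)),
      ((Equiv.Perm.sign τ : ℤ) : ℝ) *
        ((K β (i (τ 0)) : ℝ) / ((Function.update r α (r α + 1) β : ℕ) + 1 : ℝ)) *
        appT (Bop α X) (fun l => i (τ l.succ))
          (Function.update K β (subF (K β) (i (τ 0))))
      = (((k+1).factorial : ℕ) : ℝ)⁻¹ * ∑ σ : Equiv.Perm (Fin (k+1)),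
          FF β α X i K (τ * Equiv.Perm.decomposeFin.symm (0, σ)) := by
    intro τ
    rw [appT_Bop, Bval_succ, mul_left_comm, Finset.mul_sum]
    congr 1
    apply Finset.sum_congr rfl
    intro σ _
    have h1 : Equiv.Perm.decomposeFin.symm ((0 : Fin (k+1+1)), σ) 0 = 0 := by simp
    have h2 : ∀ l : Fin (k+1),
        Equiv.Perm.decomposeFin.symm ((0 : Fin (k+1+1)), σ) l.succ = (σ l).succ := by
      intro l; simp
    have h3 : Equiv.Perm.decomposeFin.symm ((0 : Fin (k+1+1)), σ) 1 = (σ 0).succ := by simp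
    have h4 : Equiv.Perm.sign (Equiv.Perm.decomposeFin.symm ((0 : Fin (k+1+1)), σ))
        = Equiv.Perm.sign σ := by simp
    unfold FF
    simp only [Equiv.Perm.mul_apply, h1, h2, h3, map_mul, h4]
    push_cast
    ring
  rw [Finset.sum_congr rfl (fun τ _ => key τ), ← Finset.mul_sum, Finset.sum_comm]
  have h5 : ∀ σ : Equiv.Perm (Fin (k+1)),
      ∑ τ, FF β α X i K (τ * Equiv.Perm.decomposeFin.symm (0, σ)) = ∑ τ, FF β α X i K τ := by
    intro σ
    exact Equiv.sum_comp (Equiv.mulRight (Equiv.Perm.decomposeFin.symm ((0 : Fin (k+1+1)), σ)))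
      (FF β α X i K)
  rw [Finset.sum_congr rfl (fun σ _ => h5 σ), Finset.sum_const, Finset.card_univ,
    Fintype.card_perm, Fintype.card_fin, nsmul_eq_mul, ← mul_assoc, inv_mul_cancel₀, one_mul]
  exact_mod_cast Nat.factorial_ne_zero _

theorem FF_swap {n k s : ℕ} {r : Fin s → ℕ} (β α : Fin s) (X : TT n k s r)
    (i : Fin (k+1+1) → Fin n) (K : Fin s → (Fin n → ℕ)) (τ : Equiv.Perm (Fin (k+1+1))) :
    FF α β X i K (τ * Equiv.swap 0 1) = - FF β α X i K τ := by
  unfold FF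
  have h2 : ∀ l : Fin k, Equiv.swap (0 : Fin (k+1+1)) 1 l.succ.succ = l.succ.succ := by
    intro l
    apply Equiv.swap_apply_of_ne_of_ne
    · exact Fin.succ_ne_zero _
    · rw [← Fin.succ_zero_eq_one]
      exact fun h => Fin.succ_ne_zero _ (Fin.succ_injective _ h)
  have h4 : Equiv.Perm.sign (Equiv.swap (0 : Fin (k+1+1)) 1) = -1 :=
    Equiv.Perm.sign_swap (by simp)
  simp only [Equiv.Perm.mul_apply, h2, map_mul, h4, Equiv.swap_apply_left,
    Equiv.swap_apply_right]
  generalize i (τ 0) = a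
  generalize i (τ 1) = b
  by_cases hαβ : α = β
  · subst hαβ
    simp only [Function.update_self, Function.update_idem]
    have e1 : subF (subF (K α) b) a = subF (subF (K α) a) b := by
      funext j; unfold subF; omega
    have e2 : ((K α b : ℝ)) * (subF (K α) b a : ℕ) = (K α a : ℝ) * (subF (K α) a b : ℕ) := by
      by_cases hab : a = b
      · subst hab; rfl
      · have hba : ¬ b = a := fun h => hab h.symm
        simp [subF, hab, hba, mul_comm]
    rw [e1]
    push_cast
    linear_combination (-((Equiv.Perm.sign τ : ℤ) : ℝ) / ((r α + 1 + 1 : ℝ)) / ((r α : ℝ) + 1) *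
      appT X (fun l : Fin k => i (τ l.succ.succ))
        (Function.update K α (subF (subF (K α) a) b))) * e2
  · have hβα : ¬ β = α := fun h => hαβ h.symm
    simp only [Function.update_of_ne hαβ, Function.update_of_ne hβα, Function.update_self]
    rw [Function.update_comm hαβ]
    push_cast
    ring

theorem Top_anti {n m s : ℕ} {r : Fin s → ℕ} (α : Fin s) (X : TT n (m+1) s r) (hX : IsAnti X) :
    IsAnti (Top α X) := by
  intro τ i I
  change Tval α X (i ∘ τ : Fin m → Fin n) _ = _ * Tval α X (i : Fin m → Fin n) _
  unfold Tval
  rw [Finset.mul_sum]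
  apply Finset.sum_congr rfl
  intro j _
  have h4 : Equiv.Perm.sign (Equiv.Perm.decomposeFin.symm ((0 : Fin (m+1)), τ))
        = Equiv.Perm.sign τ := by simp
  have := appT_anti X hX (Equiv.Perm.decomposeFin.symm ((0 : Fin (m+1)), τ)) (Fin.cons j i)
    (Function.update (fun β => (I β).1) α (addF ((fun β => (I β).1) α) j))
  rw [h4] at this
  rw [← this]
  congr 1
  funext l
  refine Fin.cases ?_ (fun l => ?_) l
  · simp
  · simp

theorem Bval_anti {n k s : ℕ} {r : Fin s → ℕ} (α : Fin s) (X : TT n k s r) (hX : IsAnti X)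
    (i : Fin (k+1) → Fin n) (K : Fin s → (Fin n → ℕ)) :
    ((k : ℝ) + 1) * ((r α : ℝ) + 1) * Bval α X i K =
      ∑ p : Fin (k+1), (if p = 0 then (1 : ℝ) else -1) * (K α (i p) : ℝ) *
        appT X (fun l : Fin k => i (Equiv.swap 0 p l.succ))
          (Function.update K α (subF (K α) (i p))) := by
  rw [Bval_succ, ← Equiv.sum_comp Equiv.Perm.decomposeFin.symm, Fintype.sum_prod_type]
  have key : ∀ (p : Fin (k+1)) (e : Equiv.Perm (Fin k)),
     ((Equiv.Perm.sign (Equiv.Perm.decomposeFin.symm (p, e)) : ℤ) : ℝ) *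
       ((K α (i ((Equiv.Perm.decomposeFin.symm (p, e)) 0)) : ℝ) / ((r α : ℝ) + 1)) *
          appT X (fun l : Fin k => i ((Equiv.Perm.decomposeFin.symm (p, e)) l.succ))
            (Function.update K α (subF (K α) (i ((Equiv.Perm.decomposeFin.symm (p, e)) 0))))
      = ((r α : ℝ) + 1)⁻¹ * ((if p = 0 then (1 : ℝ) else -1) * (K α (i p) : ℝ) *
        appT X (fun l : Fin k => i (Equiv.swap 0 p l.succ))
          (Function.update K α (subF (K α) (i p)))) := by
    intro p e
    simp only [Equiv.Perm.decomposeFin.symm_sign, Equiv.Perm.decomposeFin_symm_apply_zero,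
      Equiv.Perm.decomposeFin_symm_apply_succ]
    rw [appT_anti X hX e (fun l : Fin k => i (Equiv.swap 0 p l.succ))]
    have h1 : ((Equiv.Perm.sign e : ℤ) : ℝ) * ((Equiv.Perm.sign e : ℤ) : ℝ) = 1 := by
      rw [← Int.cast_mul]
      simp
    have h2 : ((((if p = 0 then 1 else -1 : ℤˣ) * Equiv.Perm.sign e : ℤˣ) : ℤ) : ℝ)
        = (if p = 0 then (1 : ℝ) else -1) * ((Equiv.Perm.sign e : ℤ) : ℝ) := by
      split_ifs <;> simp
    rw [h2]
    linear_combination ((if p = 0 then (1 : ℝ) else -1) * ((K α (i p) : ℝ) / ((r α : ℝ) + 1)) *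
      appT X (fun l : Fin k => i (Equiv.swap 0 p l.succ))
          (Function.update K α (subF (K α) (i p)))) * h1
  simp only [key]
  simp only [Finset.sum_const, Finset.card_univ, Fintype.card_perm, Fintype.card_fin,
    nsmul_eq_mul, ← Finset.mul_sum]
  have h1 : (k.factorial : ℝ) ≠ 0 := by exact_mod_cast Nat.factorial_ne_zero _
  have h2 : (k : ℝ) + 1 ≠ 0 := by positivity
  have h3 : (r α : ℝ) + 1 ≠ 0 := by positivity
  rw [Nat.factorial_succ]
  push_cast
  field_simp

theorem cons_swap {n k : ℕ} (j : Fin n) (i : Fin k → Fin n) (p : Fin k) :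
    (fun l : Fin k => (Fin.cons j i : Fin (k+1) → Fin n) (Equiv.swap 0 p.succ l.succ))
      = Function.update i p j := by
  funext l
  by_cases h : l = p
  · subst h; simp
  · rw [Equiv.swap_apply_of_ne_of_ne (Fin.succ_ne_zero _)
      (fun h' => h (Fin.succ_injective _ h'))]
    simp [h]

theorem part_TB {n k s : ℕ} {r : Fin s → ℕ} (α : Fin s) (X : TT n k s r) (hX : IsAnti X)
    (i : Fin k → Fin n) (I : (β : Fin s) → MIe n (r β)) :
    ((k : ℝ) + 1) * ((r α : ℝ) + 1) * Tval α (Bop α X) i (fun β => (I β).1)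
      = ((n : ℝ) + (r α : ℝ) - (k : ℝ)) * X i I -
        ∑ p : Fin k, ∑ j : Fin n, ((I α).1 (i p) : ℝ) *
          appT X (Function.update i p j)
            (Function.update (fun β => (I β).1) α (addF (subF (I α).1 (i p)) j)) := by
  have hval : appT X i (fun β => (I β).1) = X i I := by
    unfold appT
    rw [dif_pos ⟨rfl, fun β => (I β).2⟩]
    rfl
  have hself : Function.update (fun β => (I β).1) α (I α).1 = fun β => (I β).1 :=
    Function.update_eq_self _ _
  unfold Tval
  rw [Finset.mul_sum]
  have step : ∀ j : Fin n, ((k : ℝ) + 1) * ((r α : ℝ) + 1) *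
      appT (Bop α X) (Fin.cons j i : Fin (k+1) → Fin n)
        (Function.update (fun β => (I β).1) α (addF (I α).1 j))
      = (((I α).1 j : ℝ) + 1) * X i I -
        ∑ p : Fin k, ((((I α).1 (i p) : ℝ) *
          appT X (Function.update i p j)
            (Function.update (fun β => (I β).1) α (addF (subF (I α).1 (i p)) j)))
          + (if i p = j then X i I else 0)) := by
    intro j
    rw [appT_Bop, Bval_anti α X hX, Fin.sum_univ_succ]
    have h0 : subF (addF (I α).1 j) j = (I α).1 := by
      funext l; unfold subF addF; omega
    simp only [Function.update_self, Function.update_idem, Fin.cons_zero, Fin.cons_succ, h0,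
      hself, cons_swap, Equiv.swap_self, Equiv.refl_apply, hval, if_true, Fin.succ_ne_zero,
      if_false]
    rw [sub_eq_add_neg, ← Finset.sum_neg_distrib]
    congr 1
    · simp [addF]
    · apply Finset.sum_congr rfl
      intro p _
      by_cases hp : i p = j
      · subst hp
        rw [if_pos rfl, h0, hself, Function.update_eq_self, hval]
        by_cases hz : (I α).1 (i p) = 0
        · simp [addF, hz]
        · have h1 : addF (subF (I α).1 (i p)) (i p) = (I α).1 := by
            funext l; unfold subF addF
            by_cases hl : l = i p
            · subst hl; simp; omega
            · simp [hl]
          rw [h1, hself, hval]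
          simp [addF]
          ring
      · rw [if_neg hp]
        have h1 : subF (addF (I α).1 j) (i p) = addF (subF (I α).1 (i p)) j := by
          funext l; unfold subF addF
          by_cases hl : l = i p
          · subst hl; simp [hp]
          · simp [hl]
        rw [h1]
        simp [addF, hp]
  rw [Finset.sum_congr rfl (fun j _ => step j), Finset.sum_sub_distrib, Finset.sum_comm
    (s := Finset.univ (α := Fin n)) (t := Finset.univ (α := Fin k))]
  simp only [Finset.sum_add_distrib, ← Finset.sum_mul]
  have hI : ∑ j, ((I α).1 j : ℝ) = r α := by
    exact_mod_cast (I α).2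
  rw [hI]
  simp
  ring

theorem part_BT {n k s : ℕ} {r : Fin s → ℕ} (α : Fin s) (X : TT n k s r) (hX : IsAnti X)
    (i : Fin k → Fin n) (I : (β : Fin s) → MIe n (r β)) :
    (k : ℝ) * (r α : ℝ) * Bval α (Top α X) i (fun β => (I β).1)
      = ∑ p : Fin k, ∑ j : Fin n, ((I α).1 (i p) : ℝ) *
          appT X (Function.update i p j)
            (Function.update (fun β => (I β).1) α (addF (subF (I α).1 (i p)) j)) := by
  cases k with
  | zero => simp
  | succ m =>
    by_cases hr : r α = 0
    · have hz : ∀ a, (I α).1 a = 0 := by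
        intro a
        have := (I α).2.trans hr
        rw [Finset.sum_eq_zero_iff] at this
        exact this a (Finset.mem_univ _)
      simp [hr, hz]
    · have h := Bval_anti (k := m) α (Top α X) (Top_anti α X hX) i (fun β => (I β).1)
      have hc : ((Function.update r α (r α - 1) α : ℕ) : ℝ) + 1 = r α := by
        rw [Function.update_self]
        have : r α - 1 + 1 = r α := by omega
        exact_mod_cast this
      rw [hc] at h
      push_cast
      refine h.trans ?_
      apply Finset.sum_congr rfl
      intro p _
      rw [appT_Top α hr X]
      unfold Tval
      rw [Finset.mul_sum]
      apply Finset.sum_congr rfl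
      intro j _
      simp only [Function.update_self, Function.update_idem]
      have e : (Fin.cons j (fun l : Fin m => i (Equiv.swap 0 p l.succ)) : Fin (m+1) → Fin n)
          = fun l => (Function.update i p j) (Equiv.swap 0 p l) := by
        funext l
        refine Fin.cases ?_ (fun l => ?_) l
        · simp
        · rw [Fin.cons_succ, Function.update_of_ne]
          intro h'
          rw [Equiv.swap_apply_eq_iff, Equiv.swap_apply_right] at h'
          exact Fin.succ_ne_zero _ h'
      rw [e, appT_anti X hX]
      by_cases hp : p = 0
      · subst hp; simp
      · rw [Equiv.Perm.sign_swap (Ne.symm hp)]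
        simp [hp]

/-- (i) the operators `B_α` anticommute (in particular `B_α ∘ B_α = 0`);
(ii) the anticommutation relation `{B_α, B_α*} = N_α − N_f + n·1` between `B_α` and its
adjoint, written via the trace maps. -/
theorem fock_anticommutation (n k s : ℕ) (hn : 1 ≤ n) (hkn : k ≤ n)
    (r : Fin s → ℕ) (X : TT n k s r) (hX : IsAnti X) :
    (∀ (α β : Fin s) (i : Fin (k+1+1) → Fin n) (K : Fin s → (Fin n → ℕ)),
        Bval β (Bop α X) i K + Bval α (Bop β X) i K = 0) ∧
    (∀ (α : Fin s) (i : Fin k → Fin n) (I : (β : Fin s) → MIe n (r β)),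
        (k : ℝ) * (r α : ℝ) * Bval α (Top α X) i (fun β => (I β).1)
          + ((k : ℝ) + 1) * ((r α : ℝ) + 1) * Tval α (Bop α X) i (fun β => (I β).1)
          = ((n : ℝ) + (r α : ℝ) - (k : ℝ)) * X i I) := by
  refine ⟨?_, ?_⟩
  · intro α β i K
    rw [Bval_Bop, Bval_Bop, ← mul_add,
      ← Equiv.sum_comp (Equiv.mulRight (Equiv.swap (0 : Fin (k+1+1)) 1)) (FF α β X i K),
      ← Finset.sum_add_distrib, Finset.sum_eq_zero, mul_zero]
    intro τ _
    rw [Equiv.coe_mulRight, FF_swap]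
    ring
  · intro α i I
    rw [part_BT α X hX, part_TB α X hX]
    ring

end FockVar
end

section
/- Fix r, s ∈ ℕ. For each σ ∈ Fin m and each multi-index I with |I| ≤ r, let P^I_σ and ξ^σ be smooth real-valued functions on J^s, and define Q^I_σ := Σ_{J : |I+J| ≤ r} (−1)^{|J|} · (I+J choose I) · d_J P^{I+J}_σ. Then, as smooth functions on J^{s+r}: Σ_{σ ∈ Fin m} Σ_{I : |I| ≤ r} (d_I ξ^σ) · P^I_σ = Σ_{σ ∈ Fin m} Σ_{I : |I| ≤ r} d_I (ξ^σ · Q^I_σ). (Rewriting of a total differential operator in divergence form.) -/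
open scoped BigOperators

namespace JetVar

/-- Multi-indices on `Fin n` of degree at most `r`. -/
abbrev MD (n r : ℕ) : Type := {J : Fin n → ℕ // (∑ i, J i) ≤ r}

noncomputable instance (n r : ℕ) : Fintype (MD n r) :=
  Fintype.ofInjective
    (fun J : MD n r => fun i : Fin n =>
      (⟨J.1 i, Nat.lt_succ_of_le ((Finset.single_le_sum
        (fun j _ => Nat.zero_le (J.1 j)) (Finset.mem_univ i)).trans J.2)⟩ : Fin (r+1)))
    (fun _a _b h => Subtype.ext (funext fun i => congrArg Fin.val (congrFun h i)))

/-- Index set for the `y` coordinates of the `r`-th order jet space. -/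
abbrev JIdx (n m r : ℕ) : Type := Fin m × MD n r

/-- The `r`-th order jet coordinate space. -/
abbrev Jet (n m r : ℕ) : Type := ((Fin n) → ℝ) × (JIdx n m r → ℝ)

variable {n m : ℕ}

/-- The coordinate `x^i`. -/
def xc (i : Fin n) {r : ℕ} (p : Jet n m r) : ℝ := p.1 i

/-- The coordinate `y^σ_J` (with the convention that it is `0` for `|J| > r`). -/
def yc (σ : Fin m) (J : Fin n → ℕ) {r : ℕ} (p : Jet n m r) : ℝ :=
  if h : (∑ i, J i) ≤ r then p.2 (σ, ⟨J, h⟩) else 0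

/-- Partial derivative along the coordinate direction `x^i`. -/
noncomputable def pdX (i : Fin n) {r : ℕ} (f : Jet n m r → ℝ) (p : Jet n m r) : ℝ :=
  fderiv ℝ f p (Pi.single i 1, 0)

/-- Partial derivative along the coordinate direction `y^σ_J`
(by convention `0` for `|J| > r`). -/
noncomputable def pdY (σ : Fin m) (J : Fin n → ℕ) {r : ℕ} (f : Jet n m r → ℝ)
    (p : Jet n m r) : ℝ :=
  if h : (∑ i, J i) ≤ r then fderiv ℝ f p (0, Pi.single (σ, (⟨J, h⟩ : MD n r)) 1) else 0

/-- Projection `J^s → J^r` for `r ≤ s`, forgetting higher order coordinates. -/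
def projJet {r s : ℕ} (h : r ≤ s) (p : Jet n m s) : Jet n m r :=
  (p.1, fun q => p.2 (q.1, ⟨q.2.1, q.2.2.trans h⟩))

/-- `J + e_i`. -/
def addE (J : Fin n → ℕ) (i : Fin n) : Fin n → ℕ := fun j => J j + (if j = i then 1 else 0)

/-- `J - e_i` (truncated subtraction). -/
def subE (J : Fin n → ℕ) (i : Fin n) : Fin n → ℕ := fun j => J j - (if j = i then 1 else 0)

/-- The `i`-th formal (total) derivative of a function on `J^r`, a function on `J^{r+1}`. -/
noncomputable def formalD (i : Fin n) {r : ℕ} (f : Jet n m r → ℝ) (p : Jet n m (r+1)) : ℝ :=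
  pdX i f (projJet (Nat.le_succ r) p)
    + ∑ q : JIdx n m r, yc q.1 (addE q.2.1 i) p * pdY q.1 q.2.1 f (projJet (Nat.le_succ r) p)

/-- Iterated formal derivatives along a list of directions. -/
noncomputable def formalDL {r : ℕ} : (l : List (Fin n)) → (Jet n m r → ℝ) →
    (Jet n m (r + l.length) → ℝ)
  | [], f => f
  | i :: l, f => formalD i (formalDL l f)

/-- The canonical list of directions attached to a multi-index
(each `i` repeated `J i` times, in increasing order of `i`). -/
def mlist (J : Fin n → ℕ) : List (Fin n) :=
  (List.finRange n).flatMap (fun i => List.replicate (J i) i)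

lemma mlist_length (J : Fin n → ℕ) : (mlist J).length = ∑ i, J i := by
  rw [mlist, List.length_flatMap]
  simp only [Function.comp_def, List.length_replicate]
  rw [Fin.sum_univ_def]

/-- The iterated formal derivative `d_I`, applying each `d_i` exactly `I i` times
(in increasing order of `i`); a function on `J^{r+|I|}`. -/
noncomputable def formalDI (I : Fin n → ℕ) {r : ℕ} (f : Jet n m r → ℝ)
    (p : Jet n m (r + ∑ i, I i)) : ℝ :=
  formalDL (mlist I) f (projJet (le_of_eq (by rw [mlist_length])) p)

/-- The Lie–Euler expression `E^I_σ(L)` of a function `L` on `J^r`, a function on `J^{2r}`. -/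
noncomputable def LieEuler {r : ℕ} (σ : Fin m) (I : Fin n → ℕ) (L : Jet n m r → ℝ)
    (p : Jet n m (2*r)) : ℝ :=
  ∑ J : MD n r,
    if h : (∑ i, (I i + J.1 i)) ≤ r then
      (-1:ℝ)^(∑ i, J.1 i) * (∏ i, (Nat.choose (I i + J.1 i) (I i) : ℝ)) *
        formalDI J.1 (pdY σ (fun i => I i + J.1 i) L)
          (projJet (by have := J.2; omega) p)
    else 0

/-- The Euler–Lagrange expression `E_σ(L)`. -/
noncomputable def EL {r : ℕ} (σ : Fin m) (L : Jet n m r → ℝ) : Jet n m (2*r) → ℝ :=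
  LieEuler σ (fun _ => 0) L


/-- The forms `Q^I_σ` built from a total differential operator with coefficients `P`. -/
noncomputable def Qfun {n m s : ℕ} (r : ℕ) (P : Fin m → (Fin n → ℕ) → Jet n m s → ℝ)
    (σ : Fin m) (I : Fin n → ℕ) (p : Jet n m (s + (r - ∑ i, I i))) : ℝ :=
  ∑ J : MD n r,
    if h : (∑ i, (I i + J.1 i)) ≤ r then
      (-1:ℝ)^(∑ i, J.1 i) * (∏ i, (Nat.choose (I i + J.1 i) (I i) : ℝ)) *
        formalDI J.1 (P σ (fun i => I i + J.1 i))
          (projJet (by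
            have h2 : (∑ i, (I i + J.1 i)) = (∑ i, I i) + (∑ i, J.1 i) :=
              Finset.sum_add_distrib
            omega) p)
    else 0



open MvPolynomial TensorProduct in
theorem exists_rho {ι E : Type*} [Ring E] [Algebra ℝ E] (D : ι → E)
    (hD : ∀ i j, D i * D j = D j * D i) :
    ∃ ρ : MvPolynomial ι ℝ →ₐ[ℝ] E, ∀ i, ρ (X i) = D i := by
  letI : CommRing (Algebra.adjoin ℝ (Set.range D)) :=
    Algebra.adjoinCommRingOfComm ℝ (by rintro _ ⟨i, rfl⟩ _ ⟨j, rfl⟩; exact hD i j)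
  refine ⟨(Algebra.adjoin ℝ (Set.range D)).val.comp
    (aeval (fun i => (⟨D i, Algebra.subset_adjoin ⟨i, rfl⟩⟩ : Algebra.adjoin ℝ (Set.range D)))), ?_⟩
  intro i
  simp

open MvPolynomial TensorProduct in
theorem abstract_ibp {n : ℕ} {A : Type*} [CommRing A] [Algebra ℝ A] (D : Fin n → A →ₗ[ℝ] A)
    (hL : ∀ i a b, D i (a * b) = D i a * b + a * D i b)
    (ρ : MvPolynomial (Fin n) ℝ →ₐ[ℝ] Module.End ℝ A) (hρ : ∀ i, ρ (X i) = D i)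
    (K : Fin n → ℕ) (a b : A) :
    ρ (∏ i, X i ^ K i) a * b = ∑ I ∈ Fintype.piFinset (fun i => Finset.range (K i + 1)),
      ((-1:ℝ)^(∑ i, (K i - I i)) * (∏ i, (Nat.choose (K i) (I i) : ℝ))) •
        ρ (∏ i, X i ^ I i) (a * ρ (∏ i, X i ^ (K i - I i)) b) := by
  have hD : ∀ i j, D i * D j = D j * D i := by
    intro i j
    rw [← hρ, ← hρ, ← map_mul, ← map_mul, mul_comm]
  let D2 : Fin n ⊕ Fin n → Module.End ℝ (A ⊗[ℝ] A) := fun s =>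
    Sum.elim (fun i => TensorProduct.map (D i) LinearMap.id)
      (fun i => TensorProduct.map LinearMap.id (D i)) s
  have hD2 : ∀ s t, D2 s * D2 t = D2 t * D2 s := by
    have hD' : ∀ i j (x : A), D i (D j x) = D j (D i x) := fun i j x =>
      LinearMap.congr_fun (hD i j) x
    rintro (i | i) (j | j) <;> ext x y <;> simp [D2, hD' i j]
  obtain ⟨ρ2, hρ2⟩ := exists_rho D2 hD2
  -- three intertwining facts
  have h1 : ∀ (q : MvPolynomial (Fin n) ℝ) (x y : A),
      ρ2 (rename Sum.inl q) (x ⊗ₜ y) = (ρ q x) ⊗ₜ y := by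
    intro q
    induction q using MvPolynomial.induction_on with
    | C c => intro x y; simp [← MvPolynomial.algebraMap_eq, TensorProduct.smul_tmul', Module.algebraMap_end_apply]
    | add p q hp hq => intro x y; simp [hp, hq, TensorProduct.add_tmul]
    | mul_X p i hp => intro x y; simp [hp, hρ2, hρ, D2]
  have h2 : ∀ (q : MvPolynomial (Fin n) ℝ) (x y : A),
      ρ2 (rename Sum.inr q) (x ⊗ₜ y) = x ⊗ₜ (ρ q y) := by
    intro q
    induction q using MvPolynomial.induction_on with
    | C c => intro x y; simp [← MvPolynomial.algebraMap_eq, Module.algebraMap_end_apply]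
    | add p q hp hq => intro x y; simp [hp, hq, TensorProduct.tmul_add]
    | mul_X p i hp => intro x y; simp [hp, hρ2, hρ, D2]
  have hmul : ∀ i (t : A ⊗[ℝ] A), LinearMap.mul' ℝ A (D2 (Sum.inl i) t + D2 (Sum.inr i) t)
      = D i (LinearMap.mul' ℝ A t) := by
    intro i t
    induction t using TensorProduct.induction_on with
    | zero => simp
    | tmul x y => simp [D2, hL]
    | add x y hx hy =>
      simp only [map_add] at hx hy ⊢
      rw [← hx, ← hy]; abel
  have h3 : ∀ (q : MvPolynomial (Fin n) ℝ) (t : A ⊗[ℝ] A),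
      LinearMap.mul' ℝ A (ρ2 (aeval (fun i => (X (Sum.inl i) + X (Sum.inr i) :
        MvPolynomial (Fin n ⊕ Fin n) ℝ)) q) t) = ρ q (LinearMap.mul' ℝ A t) := by
    intro q
    induction q using MvPolynomial.induction_on with
    | C c => intro t; simp [← MvPolynomial.algebraMap_eq, Module.algebraMap_end_apply]
    | add p q hp hq => intro t; simp only [map_add, LinearMap.add_apply, hp, hq]
    | mul_X p i hp =>
      intro t
      simp only [map_mul, aeval_X, map_add, Module.End.mul_apply, hp, hρ2, hρ, LinearMap.add_apply]
      rw [← map_add, ← map_add, hmul]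
  have key : (rename Sum.inl (∏ i, X i ^ K i : MvPolynomial (Fin n) ℝ) :
      MvPolynomial (Fin n ⊕ Fin n) ℝ) =
      ∑ I ∈ Fintype.piFinset (fun i => Finset.range (K i + 1)),
      ((-1:ℝ)^(∑ i, (K i - I i)) * (∏ i, (Nat.choose (K i) (I i) : ℝ))) •
        ((aeval (fun i => (X (Sum.inl i) + X (Sum.inr i) :
        MvPolynomial (Fin n ⊕ Fin n) ℝ)) (∏ i, X i ^ I i : MvPolynomial (Fin n) ℝ)) *
          rename Sum.inr (∏ i, X i ^ (K i - I i) : MvPolynomial (Fin n) ℝ)) := by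
    have e : ∀ i, (X (Sum.inl i) : MvPolynomial (Fin n ⊕ Fin n) ℝ) ^ K i
        = ∑ k ∈ Finset.range (K i + 1), (X (Sum.inl i) + X (Sum.inr i)) ^ k *
          (- X (Sum.inr i)) ^ (K i - k) * (Nat.choose (K i) k : MvPolynomial (Fin n ⊕ Fin n) ℝ) := by
      intro i
      rw [← add_pow]
      congr 1; ring
    simp only [map_prod, map_pow, rename_X, aeval_X]
    simp_rw [e]
    rw [Finset.prod_univ_sum]
    refine Finset.sum_congr rfl fun I _ => ?_
    rw [MvPolynomial.smul_eq_C_mul]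
    simp only [map_mul, map_pow, map_prod, map_natCast, map_neg, map_one]
    rw [← Finset.prod_pow_eq_pow_sum, ← Finset.prod_mul_distrib, ← Finset.prod_mul_distrib,
      ← Finset.prod_mul_distrib]
    refine Finset.prod_congr rfl fun i _ => ?_
    rw [neg_pow (X (Sum.inr i) : MvPolynomial (Fin n ⊕ Fin n) ℝ)]; ring
  have h4 := congrArg (fun q => LinearMap.mul' ℝ A (ρ2 q (a ⊗ₜ b))) key
  simp only [h1, map_sum, map_smul, map_mul ρ2, LinearMap.sum_apply, LinearMap.smul_apply,
    Module.End.mul_apply, h3, h2, LinearMap.mul'_apply] at h4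
  exact h4



open scoped ContDiff

/-- Infinite jet coordinate space. -/
abbrev JInf (n m : ℕ) : Type := (Fin n → ℝ) × (Fin m × (Fin n → ℕ) → ℝ)

/-- Truncation. -/
def tr {n m : ℕ} (r : ℕ) (p : JInf n m) : Jet n m r := (p.1, fun q => p.2 (q.1, q.2.1))

/-- The total derivative vector field. -/
def vf {n m : ℕ} (i : Fin n) (p : JInf n m) : JInf n m :=
  (Pi.single i 1, fun q => p.2 (q.1, addE q.2 i))

/-- Its finite level version. -/
def wf {n m r : ℕ} (i : Fin n) (p : Jet n m (r+1)) : Jet n m r :=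
  (Pi.single i 1, fun q => yc q.1 (addE q.2.1 i) p)

theorem sum_addE {n : ℕ} (J : Fin n → ℕ) (i : Fin n) : ∑ j, addE J i j = (∑ j, J j) + 1 := by
  simp [addE, Finset.sum_add_distrib]

theorem yc_of_le {n m r : ℕ} (σ : Fin m) (J : Fin n → ℕ) (h : ∑ i, J i ≤ r) (p : Jet n m r) :
    yc σ J p = p.2 (σ, ⟨J, h⟩) := by simp [yc, h]

theorem tr_vf {n m r : ℕ} (i : Fin n) (p : JInf n m) : tr r (vf i p) = wf i (tr (r+1) p) := by
  refine Prod.ext rfl (funext fun q => ?_)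
  have h : ∑ j, addE q.2.1 i j ≤ r + 1 := by rw [sum_addE]; have := q.2.2; omega
  simp [tr, vf, wf, yc_of_le _ _ h]

theorem formalD_eq {n m r : ℕ} (i : Fin n) (f : Jet n m r → ℝ) (p : Jet n m (r+1)) :
    formalD i f p = fderiv ℝ f (projJet (Nat.le_succ r) p) (wf i p) := by
  classical
  have hw : wf i p = ((Pi.single i 1, 0) : Jet n m r) + ∑ q : JIdx n m r,
      yc q.1 (addE q.2.1 i) p • ((0, Pi.single q 1) : Jet n m r) := by
    refine Prod.ext ?_ ?_
    · simp [wf, Prod.fst_sum]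
    · funext q'
      simp [wf, Prod.snd_sum, Finset.sum_apply, Pi.single_apply]
  rw [hw, map_add, map_sum]
  unfold formalD pdX
  congr 1
  refine Finset.sum_congr rfl fun q _ => ?_
  rw [map_smul, smul_eq_mul]
  congr 1
  have := q.2.2
  simp only [pdY, this, dite_true]

/-- The linear projection. -/
noncomputable def projL {n m r s : ℕ} (h : r ≤ s) : Jet n m s →L[ℝ] Jet n m r :=
  LinearMap.toContinuousLinearMap
    { toFun := projJet h, map_add' := fun _ _ => rfl, map_smul' := fun _ _ => rfl }

theorem projL_apply {n m r s : ℕ} (h : r ≤ s) (p : Jet n m s) : projL h p = projJet h p := rfl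

/-- Linear part of `wf`. -/
noncomputable def wL {n m r : ℕ} (i : Fin n) : Jet n m (r+1) →L[ℝ] Jet n m r :=
  LinearMap.toContinuousLinearMap
    { toFun := fun p => (0, fun q => yc q.1 (addE q.2.1 i) p)
      map_add' := fun a b => by
        refine Prod.ext (by simp) (funext fun q => ?_)
        have h : ∑ j, addE q.2.1 i j ≤ r + 1 := by rw [sum_addE]; have := q.2.2; omega
        simp [yc_of_le _ _ h]
      map_smul' := fun a b => by
        refine Prod.ext (by simp) (funext fun q => ?_)
        have h : ∑ j, addE q.2.1 i j ≤ r + 1 := by rw [sum_addE]; have := q.2.2; omega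
        simp [yc_of_le _ _ h] }

theorem wL_apply {n m r : ℕ} (i : Fin n) (p : Jet n m (r+1)) :
    wL i p = (0, fun q => yc q.1 (addE q.2.1 i) p) := rfl

theorem wf_eq {n m r : ℕ} (i : Fin n) (p : Jet n m (r+1)) :
    wf i p = ((Pi.single i 1, 0) : Jet n m r) + wL i p := by
  refine Prod.ext ?_ ?_ <;> simp [wf, wL_apply]

theorem formalD_eq' {n m r : ℕ} (i : Fin n) (f : Jet n m r → ℝ) :
    formalD i f = fun p => fderiv ℝ f (projL (Nat.le_succ r) p)
      (((Pi.single i 1, 0) : Jet n m r) + wL i p) := by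
  funext p; rw [formalD_eq, wf_eq, projL_apply]

theorem formalD_smooth {n m r : ℕ} (i : Fin n) {f : Jet n m r → ℝ} (hf : ContDiff ℝ ∞ f) :
    ContDiff ℝ ∞ (formalD i f) := by
  rw [formalD_eq']
  have h : ContDiff ℝ ∞ (fderiv ℝ f) := hf.fderiv_right (by simp)
  exact (h.comp (projL _).contDiff).clm_apply (contDiff_const.add (wL i).contDiff)

theorem fderiv_aux {E F : Type*} [NormedAddCommGroup E] [NormedSpace ℝ E]
    [NormedAddCommGroup F] [NormedSpace ℝ F] {f : E → ℝ} (hf : ContDiff ℝ ∞ f)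
    (L M : F →L[ℝ] E) (c : E) (p v : F) :
    fderiv ℝ (fun p => fderiv ℝ f (L p) (c + M p)) p v =
      fderiv ℝ (fderiv ℝ f) (L p) (L v) (c + M p) + fderiv ℝ f (L p) (M v) := by
  have h : ContDiff ℝ ∞ (fderiv ℝ f) := hf.fderiv_right (by simp)
  have h1 : HasFDerivAt (fderiv ℝ f) (fderiv ℝ (fderiv ℝ f) (L p)) (L p) :=
    (h.differentiable (by simp) _).hasFDerivAt
  have h2 := h1.comp p L.hasFDerivAt
  have h3 := (M.hasFDerivAt (x := p)).const_add c
  have h4 := h2.clm_apply h3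
  have h5 := h4.fderiv
  simp only [Function.comp_def] at h5
  rw [h5]
  simp [add_comm]

theorem formalD_fderiv {n m r : ℕ} (i : Fin n) {f : Jet n m r → ℝ} (hf : ContDiff ℝ ∞ f)
    (p v : Jet n m (r+1)) : fderiv ℝ (formalD i f) p v =
      fderiv ℝ (fderiv ℝ f) (projL (Nat.le_succ r) p) (projL (Nat.le_succ r) v) (wf i p)
      + fderiv ℝ f (projL (Nat.le_succ r) p) (wL i v) := by
  rw [formalD_eq', fderiv_aux hf, wf_eq]

/-- Total derivative on infinite jets. -/
noncomputable def Dinf {n m : ℕ} (i : Fin n) (F : JInf n m → ℝ) (p : JInf n m) : ℝ :=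
  deriv (fun t : ℝ => F (p + t • vf i p)) 0

theorem hasDeriv_line {n m r : ℕ} (i : Fin n) {f : Jet n m r → ℝ} (hf : ContDiff ℝ ∞ f)
    (p : JInf n m) : HasDerivAt (fun t : ℝ => f (tr r (p + t • vf i p)))
      (formalD i f (tr (r+1) p)) 0 := by
  have h1 : HasFDerivAt f (fderiv ℝ f (tr r p)) (tr r p) :=
    (hf.differentiable (by simp) _).hasFDerivAt
  have h2 := h1.hasLineDerivAt (wf i (tr (r+1) p))
  rw [formalD_eq]
  rw [← tr_vf] at h2 ⊢
  exact h2

theorem Dinf_tr {n m r : ℕ} (i : Fin n) {f : Jet n m r → ℝ} (hf : ContDiff ℝ ∞ f) :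
    Dinf i (fun p => f (tr r p)) = fun p => formalD i f (tr (r+1) p) :=
  funext fun p => (hasDeriv_line i hf p).deriv

theorem Dinf_comm {n m r : ℕ} (i j : Fin n) {f : Jet n m r → ℝ} (hf : ContDiff ℝ ∞ f) :
    Dinf i (Dinf j (fun p => f (tr r p))) = Dinf j (Dinf i (fun p => f (tr r p))) := by
  rw [Dinf_tr j hf, Dinf_tr i hf, Dinf_tr i (formalD_smooth j hf), Dinf_tr j (formalD_smooth i hf)]
  funext p
  rw [formalD_eq, formalD_eq, formalD_fderiv _ hf, formalD_fderiv _ hf]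
  have hs : IsSymmSndFDerivAt ℝ f (tr r p) :=
    hf.contDiffAt.isSymmSndFDerivAt (by
      rw [minSmoothness_of_isRCLikeNormedField]; exact WithTop.coe_le_coe.2 le_top)
  have e1 : ∀ k : Fin n, projL (Nat.le_succ r) (wf k (tr (r+1+1) p)) = wf k (tr (r+1) p) := by
    intro k
    rw [← tr_vf, ← tr_vf]; rfl
  have e2 : (wL j (wf i (tr (r+1+1) p)) : Jet n m r) = wL i (wf j (tr (r+1+1) p)) := by
    rw [← tr_vf, ← tr_vf, wL_apply, wL_apply]
    refine Prod.ext rfl (funext fun q => ?_)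
    have h : ∀ i, ∑ j, addE q.2.1 i j ≤ r + 1 := by
      intro i; rw [sum_addE]; have := q.2.2; omega
    simp only [yc_of_le _ _ (h i), yc_of_le _ _ (h j), tr, vf]
    have e3 : addE (addE q.2.1 j) i = addE (addE q.2.1 i) j := by
      funext k; simp only [addE]; ring
    rw [e3]
  rw [e1, e1, e2]
  congr 1
  exact hs _ _

/-- Algebra of smooth functions of finite order. -/
def Alg (n m : ℕ) : Subalgebra ℝ (JInf n m → ℝ) where
  carrier := {F | ∃ (r : ℕ) (f : Jet n m r → ℝ), ContDiff ℝ ∞ f ∧ F = fun p => f (tr r p)}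
  mul_mem' := by
    rintro _ _ ⟨r, f, hf, rfl⟩ ⟨s, g, hg, rfl⟩
    exact ⟨max r s, fun p => f (projL (le_max_left r s) p) * g (projL (le_max_right r s) p),
      (hf.comp (projL _).contDiff).mul (hg.comp (projL _).contDiff), rfl⟩
  add_mem' := by
    rintro _ _ ⟨r, f, hf, rfl⟩ ⟨s, g, hg, rfl⟩
    exact ⟨max r s, fun p => f (projL (le_max_left r s) p) + g (projL (le_max_right r s) p),
      (hf.comp (projL _).contDiff).add (hg.comp (projL _).contDiff), rfl⟩
  algebraMap_mem' := fun c => ⟨0, fun _ => c, contDiff_const, rfl⟩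

theorem Alg_line {n m : ℕ} (i : Fin n) (F : Alg n m) (p : JInf n m) :
    DifferentiableAt ℝ (fun t : ℝ => F.1 (p + t • vf i p)) 0 := by
  obtain ⟨_, r, f, hf, rfl⟩ := F
  exact (hasDeriv_line i hf p).differentiableAt

theorem Dinf_mul {n m : ℕ} (i : Fin n) (F G : Alg n m) :
    Dinf i (F.1 * G.1) = Dinf i F.1 * G.1 + F.1 * Dinf i G.1 := by
  funext p
  have := deriv_mul (Alg_line i F p) (Alg_line i G p)
  simp only [zero_smul, add_zero] at this
  exact this

/-- Total derivative as a linear operator. -/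
noncomputable def DA {n m : ℕ} (i : Fin n) : Alg n m →ₗ[ℝ] Alg n m where
  toFun F := ⟨Dinf i F.1, by
    obtain ⟨_, r, f, hf, rfl⟩ := F
    exact ⟨r+1, formalD i f, formalD_smooth i hf, Dinf_tr i hf⟩⟩
  map_add' F G := by
    refine Subtype.ext (funext fun p => ?_)
    exact deriv_add (Alg_line i F p) (Alg_line i G p)
  map_smul' c F := by
    refine Subtype.ext (funext fun p => ?_)
    exact deriv_const_mul c (Alg_line i F p)

theorem DA_comm {n m : ℕ} (i j : Fin n) :
    (DA i * DA j : Module.End ℝ (Alg n m)) = DA j * DA i := by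
  ext1 ⟨_, r, f, hf, rfl⟩
  exact Subtype.ext (Dinf_comm i j hf)

theorem DA_mul {n m : ℕ} (i : Fin n) (F G : Alg n m) :
    DA i (F * G) = DA i F * G + F * DA i G := Subtype.ext (Dinf_mul i F G)

/-- Pullback. -/
def pb {n m r : ℕ} (f : Jet n m r → ℝ) (hf : ContDiff ℝ ∞ f) : Alg n m :=
  ⟨fun p => f (tr r p), r, f, hf, rfl⟩

theorem formalDL_smooth {n m r : ℕ} (l : List (Fin n)) {f : Jet n m r → ℝ}
    (hf : ContDiff ℝ ∞ f) : ContDiff ℝ ∞ (formalDL l f) := by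
  induction l with
  | nil => exact hf
  | cons i l ih => exact formalD_smooth i ih

theorem formalDI_smooth {n m r : ℕ} (I : Fin n → ℕ) {f : Jet n m r → ℝ}
    (hf : ContDiff ℝ ∞ f) : ContDiff ℝ ∞ (formalDI I f) :=
  (formalDL_smooth (mlist I) hf).comp (projL (le_of_eq (by rw [mlist_length]))).contDiff

theorem pb_formalDL {n m r : ℕ} (ρ : MvPolynomial (Fin n) ℝ →ₐ[ℝ] Module.End ℝ (Alg n m))
    (hρ : ∀ i, ρ (MvPolynomial.X i) = DA i) (l : List (Fin n)) {f : Jet n m r → ℝ}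
    (hf : ContDiff ℝ ∞ f) :
    ρ ((l.map MvPolynomial.X).prod) (pb f hf) = pb (formalDL l f) (formalDL_smooth l hf) := by
  induction l with
  | nil => simp; rfl
  | cons i l ih =>
    rw [List.map_cons, List.prod_cons, map_mul, Module.End.mul_apply, ih, hρ]
    exact Subtype.ext (Dinf_tr i (formalDL_smooth l hf))

theorem mlist_prod {n : ℕ} {M : Type*} [CommMonoid M] (I : Fin n → ℕ) (x : Fin n → M) :
    ((mlist I).map x).prod = ∏ i, x i ^ I i := by
  rw [mlist, Fin.prod_univ_def]
  induction List.finRange n with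
  | nil => simp
  | cons i l ih => simp [ih]

theorem pb_formalDI {n m r : ℕ} (ρ : MvPolynomial (Fin n) ℝ →ₐ[ℝ] Module.End ℝ (Alg n m))
    (hρ : ∀ i, ρ (MvPolynomial.X i) = DA i) (I : Fin n → ℕ) {f : Jet n m r → ℝ}
    (hf : ContDiff ℝ ∞ f) :
    ρ (∏ i, MvPolynomial.X i ^ I i) (pb f hf) = pb (formalDI I f) (formalDI_smooth I hf) := by
  rw [← mlist_prod, pb_formalDL ρ hρ]
  rfl


theorem reindex {n : ℕ} {B : Type*} [AddCommMonoid B] (r : ℕ)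
    (g : (Fin n → ℕ) → (Fin n → ℕ) → B) :
    ∑ K : MD n r, ∑ I ∈ Fintype.piFinset (fun i => Finset.range (K.1 i + 1)),
      g I (fun i => K.1 i - I i)
    = ∑ I : MD n r, ∑ J : MD n r, if (∑ i, (I.1 i + J.1 i)) ≤ r then g I.1 J.1 else 0 := by
  classical
  rw [Finset.sum_sigma', ← Finset.sum_product', ← Finset.sum_filter]
  have hle : ∀ (K : MD n r) (I : Fin n → ℕ),
      I ∈ Fintype.piFinset (fun i => Finset.range (K.1 i + 1)) → ∀ i, I i ≤ K.1 i := by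
    intro K I h i
    have := Fintype.mem_piFinset.1 h i
    simp at this; omega
  refine Finset.sum_bij'
    (fun x hx => ((⟨x.2, (Finset.sum_le_sum fun i _ => hle x.1 x.2 (Finset.mem_sigma.1 hx).2 i).trans
        x.1.2⟩ : MD n r),
      (⟨fun i => x.1.1 i - x.2 i, (Finset.sum_le_sum fun i _ => Nat.sub_le _ _).trans x.1.2⟩ : MD n r)))
    (fun y hy => ⟨⟨fun i => y.1.1 i + y.2.1 i, (Finset.mem_filter.1 hy).2⟩, y.1.1⟩)
    ?_ ?_ ?_ ?_ ?_
  · rintro ⟨K, I⟩ hx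
    have h := hle K I (Finset.mem_sigma.1 hx).2
    simp only [Finset.mem_filter, Finset.mem_product, Finset.mem_univ, true_and]
    refine le_trans (le_of_eq (Finset.sum_congr rfl fun i _ => ?_)) K.2
    have := h i; omega
  · rintro ⟨I, J⟩ hy
    simp [Fintype.mem_piFinset]
  · rintro ⟨K, I⟩ hx
    have h := hle K I (Finset.mem_sigma.1 hx).2
    have : (⟨fun i => I i + (K.1 i - I i), by
        refine le_trans (le_of_eq (Finset.sum_congr rfl fun i _ => ?_)) K.2
        exact Nat.add_sub_cancel' (h i)⟩ : MD n r) = K := by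
      refine Subtype.ext (funext fun i => ?_)
      exact Nat.add_sub_cancel' (h i)
    simp only
    rw [Sigma.mk.injEq]
    exact ⟨this, HEq.rfl⟩
  · rintro ⟨I, J⟩ hy
    simp
  · rintro ⟨K, I⟩ hx
    rfl

theorem divergence_alg {n : ℕ} {A : Type*} [CommRing A] [Algebra ℝ A] (D : Fin n → A →ₗ[ℝ] A)
    (hL : ∀ i a b, D i (a * b) = D i a * b + a * D i b)
    (ρ : MvPolynomial (Fin n) ℝ →ₐ[ℝ] Module.End ℝ A) (hρ : ∀ i, ρ (MvPolynomial.X i) = D i)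
    (r : ℕ) (a : A) (b : (Fin n → ℕ) → A) :
    ∑ K : MD n r, ρ (∏ i, MvPolynomial.X i ^ K.1 i) a * b K.1 =
    ∑ I : MD n r, ρ (∏ i, MvPolynomial.X i ^ I.1 i)
      (a * ∑ J : MD n r, if (∑ i, (I.1 i + J.1 i)) ≤ r then
        ((-1:ℝ)^(∑ i, J.1 i) * (∏ i, (Nat.choose (I.1 i + J.1 i) (I.1 i) : ℝ))) •
          ρ (∏ i, MvPolynomial.X i ^ J.1 i) (b (fun i => I.1 i + J.1 i)) else 0) := by
  have h := reindex r (fun I J : Fin n → ℕ =>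
    ((-1:ℝ)^(∑ i, J i) * (∏ i, (Nat.choose (I i + J i) (I i) : ℝ))) •
      ρ (∏ i, MvPolynomial.X i ^ I i) (a * ρ (∏ i, MvPolynomial.X i ^ J i)
        (b (fun i => I i + J i))))
  refine Eq.trans ?_ (h.trans ?_)
  · refine Finset.sum_congr rfl fun K _ => ?_
    rw [abstract_ibp D hL ρ hρ]
    refine Finset.sum_congr rfl fun I hI => ?_
    have hK : ∀ i, I i + (K.1 i - I i) = K.1 i := by
      intro i
      have := Fintype.mem_piFinset.1 hI i
      simp at this; omega
    simp only [hK]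
  · refine Finset.sum_congr rfl fun I _ => ?_
    rw [Finset.mul_sum, map_sum]
    refine Finset.sum_congr rfl fun J _ => ?_
    split_ifs
    · rw [mul_smul_comm, map_smul]
    · simp

theorem Qfun_smooth {n m s : ℕ} (r : ℕ) (P : Fin m → (Fin n → ℕ) → Jet n m s → ℝ)
    (hP : ∀ σ I, ContDiff ℝ ∞ (P σ I)) (σ : Fin m) (I : Fin n → ℕ) :
    ContDiff ℝ ∞ (Qfun r P σ I) := by
  unfold Qfun
  refine ContDiff.sum fun J _ => ?_
  split_ifs with h
  · refine contDiff_const.mul ((formalDI_smooth J.1 (hP σ _)).comp (projL ?_).contDiff)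
    have h2 : (∑ i, (I i + J.1 i)) = (∑ i, I i) + (∑ i, J.1 i) := Finset.sum_add_distrib
    omega
  · exact contDiff_const

theorem pb_apply {n m r : ℕ} (f : Jet n m r → ℝ) (hf : ContDiff ℝ ∞ f) (x : JInf n m) :
    (pb f hf).1 x = f (tr r x) := rfl

theorem projJet_tr {n m r s : ℕ} (h : r ≤ s) (x : JInf n m) :
    projJet h (tr s x) = tr r x := rfl

/-- Evaluation at a point, as a ring homomorphism. -/
def evA {n m : ℕ} (x : JInf n m) : Alg n m →ₐ[ℝ] ℝ :=
  (Pi.evalAlgHom ℝ (fun _ : JInf n m => ℝ) x).comp (Alg n m).val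

theorem evA_pb {n m r : ℕ} (f : Jet n m r → ℝ) (hf : ContDiff ℝ ∞ f) (x : JInf n m) :
    evA x (pb f hf) = f (tr r x) := rfl

theorem alg_ext {n m : ℕ} {F G : Alg n m} (h : ∀ x, evA x F = evA x G) : F = G :=
  Subtype.ext (funext h)

theorem Q_pb {n m s : ℕ} (ρ : MvPolynomial (Fin n) ℝ →ₐ[ℝ] Module.End ℝ (Alg n m))
    (hρ : ∀ i, ρ (MvPolynomial.X i) = DA i) (r : ℕ)
    (P : Fin m → (Fin n → ℕ) → Jet n m s → ℝ)
    (hP : ∀ σ I, ContDiff ℝ ∞ (P σ I)) (σ : Fin m) (I : Fin n → ℕ) :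
    (∑ J : MD n r, if (∑ i, (I i + J.1 i)) ≤ r then
        ((-1:ℝ)^(∑ i, J.1 i) * (∏ i, (Nat.choose (I i + J.1 i) (I i) : ℝ))) •
          ρ (∏ i, MvPolynomial.X i ^ J.1 i)
            (pb (P σ (fun i => I i + J.1 i)) (hP σ (fun i => I i + J.1 i))) else 0)
        = pb (Qfun r P σ I) (Qfun_smooth r P hP σ I) := by
  refine alg_ext fun x => ?_
  rw [evA_pb, map_sum, Qfun]
  refine Finset.sum_congr rfl fun J _ => ?_
  split_ifs with h
  · rw [map_smul, pb_formalDI ρ hρ, evA_pb, projJet_tr, smul_eq_mul]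
  · rw [map_zero]

theorem xiQ_pb {n m s k : ℕ} (f : Jet n m s → ℝ) (hf : ContDiff ℝ ∞ f)
    (g : Jet n m (s + k) → ℝ) (hg : ContDiff ℝ ∞ g) (h : s ≤ s + k) :
    ∃ hfg : ContDiff ℝ ∞ (fun q : Jet n m (s + k) => f (projJet h q) * g q),
    pb f hf * pb g hg = pb (fun q : Jet n m (s + k) => f (projJet h q) * g q) hfg :=
  ⟨(hf.comp (projL h).contDiff).mul hg, rfl⟩

theorem divergence_Alg {n m : ℕ} (ρ : MvPolynomial (Fin n) ℝ →ₐ[ℝ] Module.End ℝ (Alg n m))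
    (hρ : ∀ i, ρ (MvPolynomial.X i) = DA i) (r : ℕ) (a : Alg n m) (b : (Fin n → ℕ) → Alg n m)
    (x : JInf n m) :
    ∑ K : MD n r, evA x (ρ (∏ i, MvPolynomial.X i ^ K.1 i) a * b K.1) =
    ∑ I : MD n r, evA x (ρ (∏ i, MvPolynomial.X i ^ I.1 i)
      (a * ∑ J : MD n r, if (∑ i, (I.1 i + J.1 i)) ≤ r then
        ((-1:ℝ)^(∑ i, J.1 i) * (∏ i, (Nat.choose (I.1 i + J.1 i) (I.1 i) : ℝ))) •
          ρ (∏ i, MvPolynomial.X i ^ J.1 i) (b (fun i => I.1 i + J.1 i)) else 0)) := by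
  rw [← map_sum, ← map_sum]
  exact congrArg (evA x) (divergence_alg (A := Alg n m) DA DA_mul ρ hρ r a b)

/-- rewriting of a total differential operator in divergence form. -/
theorem total_differential_operator_divergence_form (n m r s : ℕ)
    (hn : 1 ≤ n) (hm : 1 ≤ m)
    (P : Fin m → (Fin n → ℕ) → Jet n m s → ℝ)
    (hP : ∀ σ I, ContDiff ℝ (⊤:ℕ∞) (P σ I))
    (ξ : Fin m → Jet n m s → ℝ)
    (hξ : ∀ σ, ContDiff ℝ (⊤:ℕ∞) (ξ σ)) :
    ∀ p : Jet n m (s + r),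
      (∑ σ : Fin m, ∑ I : MD n r,
          formalDI I.1 (ξ σ) (projJet (by have := I.2; omega) p)
            * P σ I.1 (projJet (by omega : s ≤ s + r) p))
        = ∑ σ : Fin m, ∑ I : MD n r,
            formalDI I.1
              (fun q : Jet n m (s + (r - ∑ i, I.1 i)) =>
                ξ σ (projJet (by omega : s ≤ s + (r - ∑ i, I.1 i)) q) * Qfun r P σ I.1 q)
              (projJet (by have := I.2; omega :
                  s + (r - ∑ i, I.1 i) + (∑ i, I.1 i) ≤ s + r) p) := by
  intro p
  obtain ⟨P0, hP0⟩ : ∃ P0 : JInf n m, tr (s + r) P0 = p := by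
    refine ⟨(p.1, fun q => yc q.1 q.2 p), Prod.ext rfl (funext fun q => ?_)⟩
    exact yc_of_le _ _ q.2.2 p
  subst hP0
  obtain ⟨ρ, hρ⟩ := exists_rho (fun i => (DA i : Module.End ℝ (Alg n m))) DA_comm
  refine Finset.sum_congr rfl fun σ _ => ?_
  have main' := divergence_Alg ρ hρ r (pb (ξ σ) (hξ σ)) (fun I => pb (P σ I) (hP σ I)) P0
  refine Eq.trans ?_ (main'.trans ?_)
  · refine Finset.sum_congr rfl fun I _ => ?_
    rw [pb_formalDI ρ hρ, map_mul, evA_pb, evA_pb, projJet_tr, projJet_tr]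
  · refine Finset.sum_congr rfl fun I _ => ?_
    rw [Q_pb ρ hρ r P hP σ I.1]
    obtain ⟨hfg, e2⟩ := xiQ_pb (ξ σ) (hξ σ) (Qfun r P σ I.1) (Qfun_smooth r P hP σ I.1)
      (Nat.le_add_right s (r - ∑ i, I.1 i))
    rw [e2, pb_formalDI ρ hρ, evA_pb, projJet_tr]

end JetVar
end
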